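/- Let f : R → A be a local homomorphism of commutative local rings with maximal ideals 𝔪_R and 𝔪, residue fields κ_R = R/𝔪_R and κ = A/𝔪, and suppose the residue field extension κ/κ_R induced by f is algebraic and separable. Then the canonical κ-linear map Φ : Der_R(A, κ) → T^Zar, sending an R-linear derivation D : A → κ to the map it induces on 𝔪/𝔪², is bijective; i.e. the Grothendieck relative tangent space and the Zariski relative tangent space are isomorphic. -/

import Mathlib

open IsLocalRing

section RelTangent

variable (R A : Type*) [CommRing R] [CommRing A] [IsLocalRing R] [IsLocalRing A]
  [Algebra R A] [IsLocalHom (algebraMap R A)]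

/-- The image in `𝔪_A` of an element of `𝔪_R` under the local homomorphism `R → A`. -/
def mapMax (r : maximalIdeal R) : maximalIdeal A :=
  ⟨algebraMap R A r, by
    rw [IsLocalRing.mem_maximalIdeal, mem_nonunits_iff]
    exact fun h => mem_nonunits_iff.mp ((IsLocalRing.mem_maximalIdeal _).mp r.2)
      (IsLocalHom.map_nonunit _ h)⟩

/-- The class in `𝔪_A/𝔪_A²` of the image of an element of `𝔪_R`; the map
`j : 𝔪_R/𝔪_R² → 𝔪_A/𝔪_A²` induced by `R → A` sends the class of `r` to `jClass R A r`. -/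
noncomputable def jClass (r : maximalIdeal R) : (maximalIdeal A).Cotangent :=
  (maximalIdeal A).toCotangent (mapMax R A r)

/-- The Zariski relative tangent space: the kernel of the precomposition-with-`j` map
`Hom_κ(𝔪_A/𝔪_A², κ) → Hom_{κ_R}(𝔪_R/𝔪_R², κ)`, i.e. the space of `κ`-linear forms on
`𝔪_A/𝔪_A²` vanishing on the image of `j`. -/
noncomputable def TZar : Submodule (ResidueField A)
    ((maximalIdeal A).Cotangent →ₗ[ResidueField A] ResidueField A) :=
  ⨅ r : maximalIdeal R, LinearMap.ker (LinearMap.applyₗ (jClass R A r))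

end RelTangent

section DerivationsAndCotangent

variable {R A : Type*} [CommRing R] [CommRing A] [IsLocalRing A] [Algebra R A]

/-- An `R`-derivation of a local ring into its residue field, which is separable over that of `R`,
vanishes if it vanishes on the maximal ideal. -/
theorem Derivation.eq_zero_of_forall_mem_maximalIdeal [IsLocalRing R]
    [IsLocalHom (algebraMap R A)] [Algebra.IsSeparable (ResidueField R) (ResidueField A)]
    (D : Derivation R A (ResidueField A)) (hD : ∀ a ∈ maximalIdeal A, D a = 0) : D = 0 := by
  ext a
  have hsep := Algebra.IsSeparable.isSeparable (ResidueField R) (residue A a)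
  obtain ⟨P, hP⟩ := Polynomial.map_surjective (residue R) residue_surjective
    (minpoly (ResidueField R) (residue A a))
  have hres (Q : Polynomial R) : residue A (Polynomial.aeval a Q) =
      Polynomial.aeval (residue A a) (Q.map (residue R)) := by
    rw [← ResidueField.algebraMap_eq R, Polynomial.aeval_map_algebraMap,
      ← ResidueField.algebraMap_eq A, Polynomial.aeval_algebraMap_apply]
  have hmem : Polynomial.aeval a P ∈ maximalIdeal A := by
    rw [← residue_eq_zero_iff, hres, hP, minpoly.aeval]
  have hmul : residue A (Polynomial.aeval a (Polynomial.derivative P)) * D a = 0 := by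
    have h := hD _ hmem
    rwa [Derivation.map_aeval, Algebra.smul_def, ResidueField.algebraMap_eq] at h
  refine (mul_eq_zero.mp hmul).resolve_left ?_
  rw [hres, ← Polynomial.derivative_map, hP]
  exact hsep.aeval_derivative_ne_zero (minpoly.aeval _ _)

/-- An `A`-linear map from the maximal ideal to the residue field vanishing on the image of
`maximalIdeal R` extends to an `R`-derivation, provided that the residue field extension is
separable. -/
theorem exists_derivation_extending [IsLocalRing R] [IsLocalHom (algebraMap R A)]
    [Algebra.IsSeparable (ResidueField R) (ResidueField A)]
    (ψ : maximalIdeal A →ₗ[A] ResidueField A) (hψ : ∀ r, ψ (mapMax R A r) = 0) :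
    ∃ D : Derivation R A (ResidueField A), ∀ m : maximalIdeal A, D m = ψ m := by
  let K : Ideal A := (LinearMap.ker ψ).map (maximalIdeal A).subtype
  have hK {a : A} (ha : a ∈ maximalIdeal A) : a ∈ K ↔ ψ ⟨a, ha⟩ = 0 := by
    exact ⟨fun ⟨_, hx, h⟩ => h ▸ hx, fun h => ⟨_, h, rfl⟩⟩
  have hKm : K ≤ maximalIdeal A := Submodule.map_subtype_le _ _
  have hRB (r : R) (hr : r ∈ maximalIdeal R) : algebraMap R (A ⧸ K) r = 0 := by
    rw [IsScalarTower.algebraMap_apply R A, Ideal.Quotient.algebraMap_eq,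
      Ideal.Quotient.eq_zero_iff_mem]
    exact (hK (mapMax R A ⟨r, hr⟩).2).mpr (hψ ⟨r, hr⟩)
  let : Algebra (ResidueField R) (A ⧸ K) :=
    (Ideal.Quotient.lift (maximalIdeal R) (algebraMap R (A ⧸ K)) hRB).toAlgebra
  have halg (r : R) : algebraMap (ResidueField R) (A ⧸ K) (residue R r) =
      Ideal.Quotient.mk K (algebraMap R A r) := rfl
  have hg (a : A) (ha : a ∈ K) : residue A a = 0 := (residue_eq_zero_iff a).mpr (hKm ha)
  let g : (A ⧸ K) →ₐ[ResidueField R] ResidueField A :=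
    { Ideal.Quotient.lift K (residue A) hg with
      commutes' := fun x => by
        obtain ⟨r, rfl⟩ := residue_surjective x
        rfl }
  have hgmk (a : A) : g (Ideal.Quotient.mk K a) = residue A a := rfl
  have hgsurj : Function.Surjective g := fun x => by
    obtain ⟨a, rfl⟩ := residue_surjective x
    exact ⟨_, hgmk a⟩
  have hker : IsNilpotent (RingHom.ker (g : (A ⧸ K) →+* ResidueField A)) := by
    refine ⟨2, ?_⟩
    rw [pow_two, Ideal.zero_eq_bot, eq_bot_iff, Ideal.mul_le]
    intro x hx y hy
    obtain ⟨a, rfl⟩ := Ideal.Quotient.mk_surjective x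
    obtain ⟨b, rfl⟩ := Ideal.Quotient.mk_surjective y
    have ha : residue A a = 0 := hx
    have hb : b ∈ maximalIdeal A := (residue_eq_zero_iff b).mp hy
    rw [Ideal.mem_bot, ← map_mul, Ideal.Quotient.eq_zero_iff_mem,
      hK (Ideal.mul_mem_left _ a hb)]
    have : ψ (a • ⟨b, hb⟩) = 0 := by
      rw [map_smul, Algebra.smul_def, ResidueField.algebraMap_eq, ha, zero_mul]
    exact this
  have : Algebra.FormallyEtale (ResidueField R) (ResidueField A) :=
    Algebra.FormallyEtale.of_isSeparable _ _
  let σ : ResidueField A →ₐ[ResidueField R] A ⧸ K :=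
    Algebra.FormallySmooth.liftOfSurjective (AlgHom.id _ _) g hgsurj hker
  have hσ (x) : g (σ x) = x :=
    Algebra.FormallySmooth.liftOfSurjective_apply (AlgHom.id _ _) g hgsurj hker x
  have hmem {a c : A} (hc : Ideal.Quotient.mk K c = σ (residue A a)) :
      a - c ∈ maximalIdeal A := by
    rw [← residue_eq_zero_iff, map_sub, ← hgmk c, hc, hσ, sub_self]
  choose b hb using fun a : A => Ideal.Quotient.mk_surjective (σ (residue A a))
  let d (a : A) : ResidueField A := ψ ⟨a - b a, hmem (hb a)⟩
  have hd {a c : A} (hc : Ideal.Quotient.mk K c = σ (residue A a)) :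
      d a = ψ ⟨a - c, hmem hc⟩ := by
    have hcb : c - b a ∈ K := by rw [← Ideal.Quotient.eq, hc, hb]
    rw [← sub_eq_zero, ← map_sub, ← (hK (hKm hcb)).mp hcb]
    congr 1
    ext
    simp
  have hsmul (r : R) (a : A) : d (r • a) = r • d a := by
    have hc : Ideal.Quotient.mk K (r • b a) = σ (residue A (r • a)) := by
      rw [Algebra.smul_def, Algebra.smul_def, map_mul, map_mul, map_mul, hb, ← halg,
        ← σ.commutes]
      rfl
    rw [hd hc, ← algebraMap_smul A r (d a), ← map_smul]
    congr 1
    ext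
    simp [Algebra.smul_def, mul_sub]
  refine ⟨Derivation.mk'
    { toFun := d
      map_add' := fun x y => ?_
      map_smul' := hsmul } fun x y => ?_, fun m => ?_⟩
  · change d (x + y) = d x + d y
    have hc : Ideal.Quotient.mk K (b x + b y) = σ (residue A (x + y)) := by simp [hb]
    rw [hd hc, ← map_add]
    congr 1
    ext
    simp only [Submodule.coe_add]
    ring
  · have hres : residue A (b y) = residue A y := by rw [← hgmk, hb, hσ]
    have hby : y • d x = b y • d x := by
      simp only [Algebra.smul_def, ResidueField.algebraMap_eq, hres]
    change d (x * y) = x • d y + y • d x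
    rw [hby, hd (c := b x * b y) (by simp [hb]), ← map_smul, ← map_smul, ← map_add]
    congr 1
    ext
    simp only [Submodule.coe_add, Submodule.coe_smul, smul_eq_mul]
    ring
  · change d m = ψ m
    rw [hd (c := 0) (by rw [(residue_eq_zero_iff _).mpr m.2, map_zero, map_zero])]
    simp

/-- The `κ`-linear form on the cotangent space induced by a derivation `A → κ`. -/
noncomputable def Derivation.cotangentForm (D : Derivation R A (ResidueField A)) :
    (maximalIdeal A).Cotangent →ₗ[ResidueField A] ResidueField A :=
  LinearMap.extendScalarsOfSurjective (R := A) residue_surjective <|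
    Ideal.Cotangent.lift
      { toFun := fun m => D m
        map_add' := fun x y => by simp
        map_smul' := fun a m => by
          have hm : residue A (m : A) = 0 := (residue_eq_zero_iff _).mpr m.2
          simp [Algebra.smul_def, ResidueField.algebraMap_eq, hm] }
      fun x y => by
        have hx : residue A (x : A) = 0 := (residue_eq_zero_iff _).mpr x.2
        have hy : residue A (y : A) = 0 := (residue_eq_zero_iff _).mpr y.2
        simp [Algebra.smul_def, ResidueField.algebraMap_eq, hx, hy]

theorem Derivation.cotangentForm_toCotangent (D : Derivation R A (ResidueField A))
    (m : maximalIdeal A) : D.cotangentForm ((maximalIdeal A).toCotangent m) = D m := rfl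

theorem mem_TZar_iff [IsLocalRing R] [IsLocalHom (algebraMap R A)]
    {φ : (maximalIdeal A).Cotangent →ₗ[ResidueField A] ResidueField A} :
    φ ∈ TZar R A ↔ ∀ r, φ (jClass R A r) = 0 := by
  simp [TZar]

end DerivationsAndCotangent

/-- Let `f : R → A` be a local homomorphism of commutative local rings whose
induced residue field extension `κ/κ_R` is algebraic and separable.  Then the canonical
`κ`-linear map `Φ : Der_R(A, κ) → T^Zar`, sending an `R`-linear derivation `D : A → κ` to the
map it induces on `𝔪/𝔪²`, is bijective; i.e. the Grothendieck relative tangent space and the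
Zariski relative tangent space are isomorphic. -/
theorem stmt_14 (R A : Type*) [CommRing R] [CommRing A] [IsLocalRing R] [IsLocalRing A]
    [Algebra R A] [IsLocalHom (algebraMap R A)]
    [Algebra.IsAlgebraic (ResidueField R) (ResidueField A)]
    [Algebra.IsSeparable (ResidueField R) (ResidueField A)] :
    ∃ Φ : Derivation R A (ResidueField A) →ₗ[ResidueField A] TZar R A,
      (∀ (D : Derivation R A (ResidueField A)) (m : maximalIdeal A),
        ((Φ D : (maximalIdeal A).Cotangent →ₗ[ResidueField A] ResidueField A))
          ((maximalIdeal A).toCotangent m) = D m) ∧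
      Function.Bijective Φ := by
  let Φ : Derivation R A (ResidueField A) →ₗ[ResidueField A] TZar R A :=
    { toFun := fun D => ⟨D.cotangentForm, mem_TZar_iff.mpr fun r => by
        rw [jClass, Derivation.cotangentForm_toCotangent]
        exact D.map_algebraMap r⟩
      map_add' := fun D E => by
        ext x
        obtain ⟨m, rfl⟩ := (maximalIdeal A).toCotangent_surjective x
        rfl
      map_smul' := fun c D => by
        ext x
        obtain ⟨m, rfl⟩ := (maximalIdeal A).toCotangent_surjective x
        rfl }
  refine ⟨Φ, fun D m => rfl, (injective_iff_map_eq_zero Φ).mpr fun D hD => ?_, fun φ => ?_⟩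
  · refine D.eq_zero_of_forall_mem_maximalIdeal fun a ha => ?_
    exact LinearMap.congr_fun (congrArg Subtype.val hD) ((maximalIdeal A).toCotangent ⟨a, ha⟩)
  · obtain ⟨D, hD⟩ := exists_derivation_extending (R := R)
      ((φ.1.restrictScalars A).comp (maximalIdeal A).toCotangent)
      (mem_TZar_iff.mp φ.2)
    refine ⟨D, ?_⟩
    ext x
    obtain ⟨m, rfl⟩ := (maximalIdeal A).toCotangent_surjective x
    exact hD m
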